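/- Let X and Y be real Banach spaces and F : X → Y a C¹ map such that the Fréchet derivative dF|_x is a continuous linear isomorphism from X onto Y for every x ∈ X. Suppose there exists a continuous non-decreasing function β : [0,∞) → (0,∞) with ∫₀^∞ ds/β(s) = ∞ such that ‖(dF|_x)⁻¹‖ ≤ β(‖x‖) for every x ∈ X. Then F is a C¹ diffeomorphism from X onto Y, i.e. F is bijective and its inverse is C¹. -/

import Mathlib

open Set MeasureTheory

open Filter Topology

/-- If every partial lift of a path through a local homeomorphism is Lipschitz with a common
constant, then the path lifts. -/
theorem IsLocalHomeomorph.exists_lift_of_lipschitz {X Y : Type*} [MetricSpace X] [CompleteSpace X]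
    [TopologicalSpace Y] [T2Space Y] {p : X → Y} (hp : IsLocalHomeomorph p) {c : ℝ → Y}
    (hc : Continuous c) {x₀ : X} (h₀ : p x₀ = c 0) (K : NNReal)
    (hK : ∀ T : ℝ, ∀ γ : ℝ → X, T ≤ 1 → ContinuousOn γ (Icc 0 T) → γ 0 = x₀ →
      (∀ t ∈ Icc 0 T, p (γ t) = c t) → LipschitzOnWith K γ (Icc 0 T)) :
    ∃ γ : ℝ → X, ContinuousOn γ (Icc 0 1) ∧ γ 0 = x₀ ∧ ∀ t ∈ Icc (0 : ℝ) 1, p (γ t) = c t := by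
  set S : Set ℝ := {T | T ∈ Icc (0 : ℝ) 1 ∧ ∃ γ : ℝ → X, ContinuousOn γ (Icc 0 T) ∧ γ 0 = x₀ ∧
    ∀ t ∈ Icc 0 T, p (γ t) = c t}
  have hS₀ : (0 : ℝ) ∈ S :=
    ⟨by simp, fun _ => x₀, continuousOn_const, rfl, fun t ht => by simp_all⟩
  have hS₁ : BddAbove S := ⟨1, fun T hT => hT.1.2⟩
  have hγ : ∀ T, ∃ γ : ℝ → X, T ∈ S → ContinuousOn γ (Icc 0 T) ∧ γ 0 = x₀ ∧
      ∀ t ∈ Icc 0 T, p (γ t) = c t := fun T => by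
    by_cases hT : T ∈ S
    · exact ⟨hT.2.choose, fun _ => hT.2.choose_spec⟩
    · exact ⟨fun _ => x₀, fun h => absurd h hT⟩
  choose γ hγ using hγ
  have hle : ∀ s ∈ S, ∀ t ∈ S, s ≤ t → dist (γ s s) (γ t t) ≤ K * dist s t := by
    intro s hs t ht hst
    have hsub : Icc 0 s ⊆ Icc 0 t := Icc_subset_Icc_right hst
    have heq : γ s s = γ t s :=
      (T2Space.isSeparatedMap p).eqOn_of_comp_eqOn hp.isLocallyInjective
        (isPreconnected_Icc (a := (0 : ℝ)) (b := s)) (hγ s hs).1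
        ((hγ t ht).1.mono hsub)
        (fun r hr => ((hγ s hs).2.2 r hr).trans ((hγ t ht).2.2 r (hsub hr)).symm)
        (left_mem_Icc.2 hs.1.1) ((hγ s hs).2.1.trans (hγ t ht).2.1.symm)
        (right_mem_Icc.2 hs.1.1)
    rw [heq]
    exact (hK t (γ t) ht.1.2 (hγ t ht).1 (hγ t ht).2.1 (hγ t ht).2.2).dist_le_mul
      s ⟨hs.1.1, hst⟩ t ⟨ht.1.1, le_rfl⟩
  have hLip : LipschitzOnWith K (fun t => γ t t) S := by
    refine LipschitzOnWith.of_dist_le_mul fun s hs t ht => ?_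
    rcases le_total s t with h | h
    · exact hle s hs t ht h
    · rw [dist_comm, dist_comm s]
      exact hle t ht s hs h
  obtain ⟨u, -, hu, huS⟩ := exists_seq_tendsto_sSup ⟨0, hS₀⟩ hS₁
  set T := sSup S
  have hcau : CauchySeq fun n => γ (u n) (u n) := by
    rw [Metric.cauchySeq_iff']
    intro ε hε
    have hK1 : (0 : ℝ) < K + 1 := by positivity
    obtain ⟨N, hN⟩ := Metric.cauchySeq_iff'.1 hu.cauchySeq (ε / (K + 1)) (by positivity)
    refine ⟨N, fun n hn => (hLip.dist_le_mul _ (huS n) _ (huS N)).trans_lt ?_⟩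
    have h1 := hN n hn
    rw [lt_div_iff₀ hK1] at h1
    nlinarith [dist_nonneg (x := u n) (y := u N), h1]
  obtain ⟨x, hx⟩ := cauchySeq_tendsto_of_complete hcau
  have hpx : p x = c T := by
    refine tendsto_nhds_unique ((hp.continuous.tendsto x).comp hx) ?_
    refine ((hc.tendsto T).comp hu).congr fun n => ?_
    exact ((hγ _ (huS n)).2.2 _ ⟨(huS n).1.1, le_rfl⟩).symm
  obtain ⟨φ, hxφ, rfl⟩ := hp x
  have hnhds : c ⁻¹' φ.target ∈ 𝓝 T :=
    hc.continuousAt (φ.open_target.mem_nhds (hpx ▸ φ.map_source hxφ))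
  obtain ⟨ε, hε, hball⟩ := Metric.mem_nhds_iff.1 hnhds
  obtain ⟨n, hn₁, hn₂⟩ := ((hx.eventually (φ.open_source.mem_nhds hxφ)).and
    (hu.eventually (Metric.ball_mem_nhds T hε))).exists
  set s := u n
  have hs : s ∈ S := huS n
  obtain ⟨hcont, hzero, hlift⟩ := hγ s hs
  have hsT : s ≤ T := le_csSup hS₁ hs
  set t' := min (T + ε / 2) 1
  have hst' : s ≤ t' := le_min (by linarith) hs.1.2
  have htarget : ∀ r ∈ Icc s t', c r ∈ φ.target := by
    intro r hr
    apply hball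
    rw [Real.dist_eq, abs_lt] at hn₂
    have : t' ≤ T + ε / 2 := min_le_left _ _
    rw [Metric.mem_ball, Real.dist_eq, abs_lt]
    exact ⟨by linarith [hr.1, hn₂.1], by linarith [hr.2]⟩
  have hmeet : φ.symm (c s) = γ s s := by
    rw [← hlift s ⟨hs.1.1, le_rfl⟩]
    exact φ.left_inv hn₁
  have ht'S : t' ∈ S := by
    refine ⟨⟨hs.1.1.trans hst', min_le_right _ _⟩,
      fun r => if r ≤ s then γ s r else φ.symm (c r), ?_, ?_, ?_⟩
    · rw [← Icc_union_Icc_eq_Icc hs.1.1 hst']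
      refine ContinuousOn.union_of_isClosed ?_ ?_ isClosed_Icc isClosed_Icc
      · exact hcont.congr fun r hr => if_pos hr.2
      · refine (φ.continuousOn_symm.comp hc.continuousOn htarget).congr fun r hr => ?_
        rcases hr.1.eq_or_lt with rfl | h
        · simp [hmeet]
        · simp [not_le.2 h]
    · simp [hs.1.1, hzero]
    · intro r hr
      by_cases h : r ≤ s
      · simpa [h] using hlift r ⟨hr.1, h⟩
      · simpa [h] using φ.right_inv (htarget r ⟨(not_le.1 h).le, hr.2⟩)
  have ht'T : t' ≤ T := le_csSup hS₁ ht'S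
  have ht' : t' = 1 := by
    rcases min_choice (T + ε / 2) 1 with h | h
    · have : t' = T + ε / 2 := h
      linarith
    · exact h
  rw [ht'] at ht'S
  exact ht'S.2

/-- If every line through `F x₀` lifts through the local homeomorphism `F` to a path starting
at `x₀`, then `F` has a continuous inverse. -/
theorem IsLocalHomeomorph.exists_continuous_inverse_of_lift_lines {X Y : Type*}
    [TopologicalSpace X] [T2Space X] [PreconnectedSpace X]
    [AddCommGroup Y] [Module ℝ Y] [TopologicalSpace Y] [IsTopologicalAddGroup Y]
    [ContinuousSMul ℝ Y] {F : X → Y} (hF : IsLocalHomeomorph F) (x₀ : X)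
    (hlift : ∀ v : Y, ∃ γ : ℝ → X, ContinuousOn γ (Icc 0 1) ∧ γ 0 = x₀ ∧
      ∀ t ∈ Icc (0 : ℝ) 1, F (γ t) = F x₀ + t • v) :
    ∃ G : Y → X, Continuous G ∧ Function.LeftInverse G F ∧ Function.RightInverse G F := by
  choose γ hγc hγ₀ hγ using hlift
  have hcont : Continuous fun a : unitInterval × Y => γ a.2 a.1 := by
    refine hF.continuous_lift (T2Space.isSeparatedMap F)
      ⟨fun a => F x₀ + (a.1 : ℝ) • a.2, by fun_prop⟩ ?_ ?_ ?_
    · ext a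
      exact hγ a.2 a.1 a.1.2
    · simpa [hγ₀] using continuous_const
    · intro v
      exact (hγc v).comp_continuous continuous_subtype_val fun t => t.2
  have hG : Continuous fun y => γ (y - F x₀) 1 :=
    hcont.comp (f := fun y => ((1 : unitInterval), y - F x₀)) (by fun_prop)
  have hright : Function.RightInverse (fun y => γ (y - F x₀) 1) F := fun y => by
    simpa using hγ (y - F x₀) 1 (by simp)
  refine ⟨_, hG, fun x => ?_, hright⟩
  exact congr_fun ((T2Space.isSeparatedMap F).eq_of_comp_eq hF.isLocallyInjective
    (hG.comp hF.continuous) continuous_id (funext fun x => hright (F x)) (γ (0 : Y) 1)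
    (congrArg (fun y => γ (y - F x₀) 1) (by simpa using hγ 0 1 (by simp)) |>.trans (by simp))) x

/-- A continuous lift of a differentiable path through a map with invertible strict derivative
is differentiable. -/
theorem HasStrictFDerivAt.hasDerivWithinAt_of_lift {X Y : Type*}
    [NormedAddCommGroup X] [NormedSpace ℝ X] [CompleteSpace X]
    [NormedAddCommGroup Y] [NormedSpace ℝ Y] {F : X → Y} {γ : ℝ → X} {c : ℝ → Y} {c' : Y}
    {s : Set ℝ} {t : ℝ} {e : X ≃L[ℝ] Y} (hF : HasStrictFDerivAt F (e : X →L[ℝ] Y) (γ t))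
    (hc : HasDerivWithinAt c c' s t) (hγ : ContinuousWithinAt γ s t) (ht : t ∈ s)
    (hlift : ∀ r ∈ s, F (γ r) = c r) : HasDerivWithinAt γ (e.symm c') s t := by
  have h₁ : HasFDerivAt (hF.localInverse F e (γ t)) (e.symm : Y →L[ℝ] X) (c t) := by
    rw [← hlift t ht]
    exact hF.to_localInverse.hasFDerivAt
  refine (h₁.comp_hasDerivWithinAt t hc).congr_of_eventuallyEq_of_mem ?_ ht
  filter_upwards [hγ.eventually hF.eventually_left_inverse, self_mem_nhdsWithin] with r hr hrs
  rw [Function.comp_apply, ← hlift r hrs, hr]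

/-- A path whose speed is controlled by `C / b ‖γ‖`, with `b` antitone, satisfies the integrated
growth bound. -/
theorem integral_norm_le_of_antitone_mul_norm_deriv_le {X : Type*} [NormedAddCommGroup X]
    [NormedSpace ℝ X] {b : ℝ → ℝ} (hb : Continuous b) (hanti : Antitone b) (hpos : ∀ r, 0 < b r)
    {γ γ' : ℝ → X} {T C : ℝ} (hγ : ∀ t ∈ Icc 0 T, HasDerivWithinAt γ (γ' t) (Icc 0 T) t)
    (hγ₀ : γ 0 = 0) (hC : ∀ t ∈ Icc 0 T, b ‖γ t‖ * ‖γ' t‖ ≤ C) :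
    ∀ t ∈ Icc 0 T, ∫ r in (0 : ℝ)..‖γ t‖, b r ≤ C * t := by
  have hΦ : Continuous fun r => ∫ s in (0 : ℝ)..r, b s :=
    continuous_iff_continuousAt.2 fun r =>
      (intervalIntegral.integral_hasDerivAt_right (hb.intervalIntegrable _ _)
        (hb.stronglyMeasurableAtFilter _ _) hb.continuousAt).continuousAt
  have hconc : ∀ p q : ℝ, (∫ s in (0 : ℝ)..q, b s) - (∫ s in (0 : ℝ)..p, b s)
      ≤ b p * (q - p) := by
    intro p q
    rw [intervalIntegral.integral_interval_sub_left (hb.intervalIntegrable _ _)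
      (hb.intervalIntegrable _ _)]
    rcases le_total p q with h | h
    · have := intervalIntegral.integral_mono_on (μ := volume) h (hb.intervalIntegrable _ _)
        (intervalIntegrable_const (c := b p)) fun s hs => hanti hs.1
      simpa [mul_comm] using this
    · have := intervalIntegral.integral_mono_on (μ := volume) h (intervalIntegrable_const (c := b p))
        (hb.intervalIntegrable _ _) fun s hs => hanti hs.2
      rw [intervalIntegral.integral_symm]
      simp only [intervalIntegral.integral_const, smul_eq_mul] at this
      linarith
  have hγc : ContinuousOn γ (Icc 0 T) := fun t ht => (hγ t ht).continuousWithinAt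
  intro t ht
  refine image_le_of_liminf_slope_right_le_deriv_boundary
    (f := fun t => ∫ r in (0 : ℝ)..‖γ t‖, b r) (B := fun t => C * t) (B' := fun _ => C)
    (hΦ.comp_continuousOn hγc.norm) (by simp [hγ₀]) (by fun_prop)
    (fun x _ => by simpa using ((hasDerivAt_id x).const_mul C).hasDerivWithinAt) ?_ ht
  intro x hx r hr
  have hx' : x ∈ Icc 0 T := Ico_subset_Icc_self hx
  have hder : HasDerivWithinAt γ (γ' x) (Ici x) x :=
    (hγ x hx').mono_of_mem_nhdsWithin <|
      mem_of_superset (Icc_mem_nhdsGE hx.2) (Icc_subset_Icc_left hx.1)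
  have hlt : ‖γ' x‖ < r / b ‖γ x‖ := by
    rw [lt_div_iff₀ (hpos _), mul_comm]
    exact (hC x hx').trans_lt hr
  refine ((hder.liminf_right_slope_norm_le hlt).and_eventually self_mem_nhdsWithin).mono ?_
  rintro z ⟨hz, hxz : x < z⟩
  rw [lt_div_iff₀ (hpos _)] at hz
  rw [slope_def_module, smul_eq_mul]
  refine lt_of_le_of_lt ?_ hz
  have := mul_le_mul_of_nonneg_left (hconc ‖γ x‖ ‖γ z‖) (inv_nonneg.2 (sub_nonneg.2 hxz.le))
  linarith

/-- A nonnegative continuous function with infinite integral on `(0, ∞)` has unbounded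
primitive. -/
theorem exists_lt_intervalIntegral_of_lintegral_eq_top {b : ℝ → ℝ} (hb : Continuous b)
    (hpos : ∀ r, 0 ≤ b r) (htop : ∫⁻ s in Ioi (0 : ℝ), ENNReal.ofReal (b s) = ⊤) (C : ℝ) :
    ∃ R : ℝ, 0 ≤ R ∧ C < ∫ s in (0 : ℝ)..R, b s := by
  by_contra! h
  have hint : IntegrableOn b (Ioi 0) := by
    refine integrableOn_Ioi_of_intervalIntegral_norm_bounded (l := atTop) (b := id) C 0
      (fun i => (hb.integrableOn_Icc).mono_set Ioc_subset_Icc_self) tendsto_id ?_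
    filter_upwards [eventually_ge_atTop 0] with i hi
    simpa [abs_of_nonneg (hpos _)] using h i hi
  exact hint.lintegral_lt_top.ne htop

/-- **Hadamard–Lévy theorem.** If `F : X → Y` is a `C¹` map between real Banach
spaces whose differential at every point is a continuous linear isomorphism, and
`‖(dF|_x)⁻¹‖ ≤ β(‖x‖)` for a continuous nondecreasing `β : [0,∞) → (0,∞)` with
`∫₀^∞ ds / β(s) = ∞`, then `F` is a `C¹` diffeomorphism from `X` onto `Y`. -/
theorem hadamard_levy
    {X Y : Type*} [NormedAddCommGroup X] [NormedSpace ℝ X] [CompleteSpace X]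
    [NormedAddCommGroup Y] [NormedSpace ℝ Y] [CompleteSpace Y]
    (F : X → Y) (hF : ContDiff ℝ 1 F)
    (e : X → (X ≃L[ℝ] Y)) (he : ∀ x : X, (e x : X →L[ℝ] Y) = fderiv ℝ F x)
    (β : ℝ → ℝ)
    (hβc : ContinuousOn β (Ici 0)) (hβm : MonotoneOn β (Ici 0))
    (hβpos : ∀ s : ℝ, 0 ≤ s → 0 < β s)
    (hβdiv : ∫⁻ s in Ioi (0:ℝ), ENNReal.ofReal (1 / β s) = ⊤)
    (hbound : ∀ x : X, ‖((e x).symm : Y →L[ℝ] X)‖ ≤ β ‖x‖) :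
    Function.Bijective F ∧
      ∃ G : Y → X, ContDiff ℝ 1 G ∧ Function.LeftInverse G F ∧
        Function.RightInverse G F := by
  have hstrict : ∀ x, HasStrictFDerivAt F (e x : X →L[ℝ] Y) x := fun x => by
    rw [he x]
    exact hF.contDiffAt.hasStrictFDerivAt one_ne_zero
  have hhomeo : IsLocalHomeomorph F := fun x =>
    ⟨(hstrict x).toOpenPartialHomeomorph F, (hstrict x).mem_toOpenPartialHomeomorph_source, rfl⟩
  set b : ℝ → ℝ := fun r => 1 / β (max r 0) with hbdef
  have hβ₀ : ∀ r, 0 < β (max r 0) := fun r => hβpos _ (le_max_right _ _)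
  have hb : Continuous b := continuous_const.div
    (hβc.comp_continuous (by fun_prop) fun r => le_max_right r 0) fun r => (hβ₀ r).ne'
  have hbpos : ∀ r, 0 < b r := fun r => one_div_pos.2 (hβ₀ r)
  have hanti : Antitone b := fun r s hrs => one_div_le_one_div_of_le (hβ₀ r)
    (hβm (le_max_right r 0) (le_max_right s 0) (max_le_max_right 0 hrs))
  have htop : ∫⁻ s in Ioi (0 : ℝ), ENNReal.ofReal (b s) = ⊤ := by
    rw [← hβdiv]
    refine setLIntegral_congr_fun measurableSet_Ioi fun s (hs : 0 < s) => ?_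
    simp [hbdef, max_eq_left hs.le]
  obtain ⟨G, hGc, hleft, hright⟩ := hhomeo.exists_continuous_inverse_of_lift_lines 0 fun v => by
    obtain ⟨R, hR, hvR⟩ :=
      exists_lt_intervalIntegral_of_lintegral_eq_top hb (fun r => (hbpos r).le) htop ‖v‖
    have hspeed : ∀ x : X, ‖(e x).symm v‖ ≤ β ‖x‖ * ‖v‖ := fun x =>
      ((e x).symm : Y →L[ℝ] X).le_of_opNorm_le (hbound x) v
    refine hhomeo.exists_lift_of_lipschitz (c := fun t => F 0 + t • v) (by fun_prop) (by simp)
      (Real.toNNReal (β R * ‖v‖)) fun T γ hT hγc hγ₀ hγ => ?_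
    have hder : ∀ t ∈ Icc 0 T, HasDerivWithinAt γ ((e (γ t)).symm v) (Icc 0 T) t := fun t ht =>
      (hstrict (γ t)).hasDerivWithinAt_of_lift
        (by simpa using (((hasDerivAt_id t).smul_const v).const_add (F 0)).hasDerivWithinAt)
        (hγc t ht) ht hγ
    have hgrowth := integral_norm_le_of_antitone_mul_norm_deriv_le hb hanti hbpos hder hγ₀
      (C := ‖v‖) fun t _ => by
        simp only [hbdef, max_eq_left (norm_nonneg (γ t))]
        rw [one_div, inv_mul_le_iff₀ (hβpos _ (norm_nonneg _))]
        exact hspeed _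
    have hγR : ∀ t ∈ Icc 0 T, ‖γ t‖ ≤ R := by
      intro t ht
      by_contra! hlt
      have h₁ : ∫ s in (0 : ℝ)..R, b s ≤ ∫ s in (0 : ℝ)..‖γ t‖, b s :=
        intervalIntegral.integral_mono_interval le_rfl hR hlt.le
          (Eventually.of_forall fun s => (hbpos s).le) (hb.intervalIntegrable _ _)
      have h₂ : ‖v‖ * t ≤ ‖v‖ := mul_le_of_le_one_right (norm_nonneg v) (ht.2.trans hT)
      linarith [hgrowth t ht]
    refine LipschitzOnWith.of_dist_le_mul fun s hs t ht => ?_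
    rw [dist_eq_norm, dist_eq_norm,
      Real.coe_toNNReal _ (mul_nonneg (hβpos R hR).le (norm_nonneg v))]
    exact (convex_Icc 0 T).norm_image_sub_le_of_norm_hasDerivWithin_le hder
      (fun r hr => (hspeed _).trans <| mul_le_mul_of_nonneg_right
        (hβm (norm_nonneg _) hR (hγR r hr)) (norm_nonneg v)) ht hs
  refine ⟨⟨hleft.injective, hright.surjective⟩, G, ?_, hleft, hright⟩
  exact Homeomorph.contDiff_symm ⟨⟨F, G, hleft, hright⟩, hF.continuous, hGc⟩
    (fun x => (hstrict x).hasFDerivAt) hF
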